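/- Let w : ℝ → ℝ be smooth with w and w' square-integrable. Then: (1) ∫ (w')² + 16 ∫ w² − (44/5) ∫ Q³ w² ≥ 0; consequently ∫ (w')² + (35/2) ∫ w² − (47/5) ∫ Q³ w² ≥ 0. (2) If moreover ∫ w Q³ = 0 and ∫ w Q' Q^{1/2} = 0, then ∫ (w')² − (27/5) ∫ Q³ w² ≥ 0. -/

import Mathlib

open Real MeasureTheory Filter

noncomputable def Q (x : ℝ) : ℝ := (5 / (2 * Real.cosh (3 * x / 2) ^ 2)) ^ ((1:ℝ)/3)

open Topology

section General

/-- If `g' ≤ f` with `f` integrable and `g` vanishes at infinity, then `∫ f ≥ 0`. -/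
lemma integral_nonneg_of_hasDerivAt_le {f g : ℝ → ℝ} (hf : Integrable f)
    (hg : ∀ x, ∃ d ≤ f x, HasDerivAt g d x) (hg0 : Tendsto g (cocompact ℝ) (𝓝 0)) :
    0 ≤ ∫ x, f x := by
  choose g' hle hder using hg
  rw [cocompact_eq_atBot_atTop, tendsto_sup] at hg0
  have hint := intervalIntegral_tendsto_integral hf tendsto_neg_atTop_atBot tendsto_id
  have hbd : Tendsto (fun r : ℝ => g r - g (-r)) atTop (𝓝 0) := by
    simpa using hg0.2.sub (hg0.1.comp tendsto_neg_atTop_atBot)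
  refine le_of_tendsto_of_tendsto hbd hint ?_
  filter_upwards [eventually_ge_atTop 0] with r hr
  exact intervalIntegral.sub_le_integral_of_hasDeriv_right_of_le (by simpa using by linarith)
    (fun x _ => (hder x).continuousAt.continuousWithinAt)
    (fun x _ => (hder x).hasDerivWithinAt) hf.integrableOn (fun x _ => hle x)

/-- A function whose square and whose derivative's square are integrable vanishes at infinity. -/
lemma tendsto_cocompact_zero_of_sq_integrable {w w' : ℝ → ℝ} (hw : ∀ x, HasDerivAt w (w' x) x)
    (hw' : Continuous w') (hw2 : Integrable (fun x => w x ^ 2))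
    (hw'2 : Integrable (fun x => w' x ^ 2)) : Tendsto w (cocompact ℝ) (𝓝 0) := by
  have hwc : Continuous w := continuous_iff_continuousAt.2 fun x => (hw x).continuousAt
  have hder : ∀ x, HasDerivAt (fun y => w y ^ 2) (2 * w x * w' x) x := fun x => by
    simpa using (hw x).fun_pow 2
  have hint : Integrable (fun x => 2 * w x * w' x) := by
    refine (hw2.add hw'2).mono' (by fun_prop) (ae_of_all _ fun x => ?_)
    rw [Real.norm_eq_abs, abs_le, Pi.add_apply]
    constructor <;> nlinarith [sq_nonneg (w x - w' x), sq_nonneg (w x + w' x)]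
  have hsq : Tendsto (fun x => w x ^ 2) (cocompact ℝ) (𝓝 0) := by
    rw [cocompact_eq_atBot_atTop, tendsto_sup]
    exact ⟨tendsto_zero_of_hasDerivAt_of_integrableOn_Iic (a := 0) (fun x _ => hder x)
        hint.integrableOn hw2.integrableOn,
      tendsto_zero_of_hasDerivAt_of_integrableOn_Ioi (a := 0) (fun x _ => hder x)
        hint.integrableOn hw2.integrableOn⟩
  have habs := hsq.sqrt
  simp only [Real.sqrt_sq_eq_abs, Real.sqrt_zero] at habs
  exact (tendsto_zero_iff_abs_tendsto_zero _).2 habs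

/-- Jacobi's completion of the square: if `φ'' = -V φ` at `x`, then the derivative of
`(φ'/φ) u²` at `x` is at most `u'² - V u²`, also at a simple zero of `φ` where `u` vanishes. -/
lemma exists_hasDerivAt_logDeriv_mul_sq_le {φ φ₁ u : ℝ → ℝ} {V u' x : ℝ}
    (hφ : HasDerivAt φ (φ₁ x) x) (hφ₁ : HasDerivAt φ₁ (-V * φ x) x) (hu : HasDerivAt u u' x)
    (hz : φ x = 0 → φ₁ x ≠ 0 ∧ u x = 0) :
    ∃ d ≤ u' ^ 2 - V * u x ^ 2, HasDerivAt (fun y => φ₁ y / φ y * u y ^ 2) d x := by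
  by_cases h : φ x = 0
  · obtain ⟨h1, h2⟩ := hz h
    refine ⟨u' ^ 2, by simp [h2], ?_⟩
    rw [hasDerivAt_iff_tendsto_slope] at hφ hu ⊢
    have hlim := ((hφ₁.continuousAt.tendsto.mono_left nhdsWithin_le_nhds).div hφ h1).mul (hu.pow 2)
    rw [div_self h1, one_mul] at hlim
    refine hlim.congr' ?_
    filter_upwards [self_mem_nhdsWithin] with y hy
    have hyx : y - x ≠ 0 := sub_ne_zero.2 hy
    simp only [slope_def_field, h, h2, Pi.div_apply, sub_zero, ne_eq, OfNat.ofNat_ne_zero,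
      not_false_eq_true, zero_pow, mul_zero]
    by_cases hy0 : φ y = 0
    · simp [hy0]
    · field_simp
  · refine ⟨_, ?_, (hφ₁.div hφ h).mul (hu.fun_pow 2)⟩
    have e : (-V * φ x * φ x - φ₁ x * φ₁ x) / φ x ^ 2 = -V - (φ₁ x / φ x) ^ 2 := by
      field_simp
    rw [e]
    simp only [Pi.div_apply, Nat.cast_ofNat, Nat.add_one_sub_one, pow_one]
    nlinarith [sq_nonneg (u' - φ₁ x / φ x * u x)]

end General

section GroundState

/-- `sech (3x/2)`. -/
noncomputable def sechProfile (x : ℝ) : ℝ := (cosh (3 * x / 2))⁻¹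

/-- `tanh (3x/2)`. -/
noncomputable def tanhProfile (x : ℝ) : ℝ := tanh (3 * x / 2)

lemma sechProfile_pos (x : ℝ) : 0 < sechProfile x := inv_pos.2 (cosh_pos _)

lemma tanhProfile_sq (x : ℝ) : tanhProfile x ^ 2 = 1 - sechProfile x ^ 2 := by
  have h := (cosh_pos (3 * x / 2)).ne'
  have h2 := cosh_sq (3 * x / 2)
  rw [tanhProfile, sechProfile, tanh_eq_sinh_div_cosh]
  field_simp
  linarith

lemma abs_tanhProfile_le_one (x : ℝ) : |tanhProfile x| ≤ 1 :=
  (sq_le_one_iff_abs_le_one _).1 (tanh_sq_lt_one _).le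

lemma hasDerivAt_sechProfile (x : ℝ) :
    HasDerivAt sechProfile (-(3 / 2) * tanhProfile x * sechProfile x) x := by
  have h := (cosh_pos (3 * x / 2)).ne'
  have hlin : HasDerivAt (fun y : ℝ => 3 * y / 2) (3 / 2) x := by
    simpa using ((hasDerivAt_id x).const_mul 3).div_const 2
  refine (hlin.cosh.fun_inv h).congr_deriv ?_
  rw [tanhProfile, sechProfile, tanh_eq_sinh_div_cosh]
  field_simp

lemma hasDerivAt_tanhProfile (x : ℝ) :
    HasDerivAt tanhProfile (3 / 2 * sechProfile x ^ 2) x := by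
  have h := (cosh_pos (3 * x / 2)).ne'
  have h2 := cosh_sq (3 * x / 2)
  have hlin : HasDerivAt (fun y : ℝ => 3 * y / 2) (3 / 2) x := by
    simpa using ((hasDerivAt_id x).const_mul 3).div_const 2
  have e : tanhProfile = fun y => sinh (3 * y / 2) / cosh (3 * y / 2) :=
    funext fun y => tanh_eq_sinh_div_cosh _
  rw [e]
  refine (hlin.sinh.fun_div hlin.cosh h).congr_deriv ?_
  rw [sechProfile]
  field_simp
  linarith

@[fun_prop]
lemma continuous_sechProfile : Continuous sechProfile :=
  continuous_iff_continuousAt.2 fun x => (hasDerivAt_sechProfile x).continuousAt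

@[fun_prop]
lemma continuous_tanhProfile : Continuous tanhProfile :=
  continuous_iff_continuousAt.2 fun x => (hasDerivAt_tanhProfile x).continuousAt

lemma sechProfile_sq_le (x : ℝ) : sechProfile x ^ 2 ≤ (1 + x ^ 2)⁻¹ := by
  rw [sechProfile, inv_pow]
  refine inv_anti₀ (by positivity) ?_
  have h : |3 * x / 2| ≤ |sinh (3 * x / 2)| := by
    rw [abs_sinh]
    exact self_le_sinh_iff.2 (abs_nonneg _)
  rw [cosh_sq]
  nlinarith [sq_le_sq.2 h, sq_nonneg x]

lemma integrable_sechProfile_sq : Integrable (fun x => sechProfile x ^ 2) := by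
  refine integrable_inv_one_add_sq.mono' (by fun_prop) (ae_of_all _ fun x => ?_)
  rw [Real.norm_of_nonneg (sq_nonneg _)]
  exact sechProfile_sq_le x

lemma sechProfile_le_one (x : ℝ) : sechProfile x ≤ 1 := inv_le_one_of_one_le₀ (one_le_cosh _)

lemma tendsto_sechProfile : Tendsto sechProfile (cocompact ℝ) (𝓝 0) := by
  refine tendsto_cocompact_zero_of_sq_integrable hasDerivAt_sechProfile (by fun_prop)
    integrable_sechProfile_sq ?_
  refine (integrable_sechProfile_sq.const_mul (9 / 4)).mono' (by fun_prop)
    (ae_of_all _ fun x => ?_)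
  rw [Real.norm_of_nonneg (sq_nonneg _), mul_pow, mul_pow, tanhProfile_sq]
  nlinarith [sq_nonneg (sechProfile x ^ 2)]

lemma Q_eq_rpow (x : ℝ) : Q x = (5 / 2 * sechProfile x ^ 2) ^ ((1 : ℝ) / 3) := by
  rw [Q, sechProfile, inv_pow]
  congr 1
  field_simp

lemma Q_pow_three (x : ℝ) : Q x ^ 3 = 5 / 2 * sechProfile x ^ 2 := by
  rw [Q_eq_rpow, ← Real.rpow_natCast, ← Real.rpow_mul (by positivity)]
  norm_num

lemma hasDerivAt_Q (x : ℝ) : HasDerivAt Q (-tanhProfile x * Q x) x := by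
  have hpos : 0 < 5 / 2 * sechProfile x ^ 2 := by have := sechProfile_pos x; positivity
  have e : Q = fun y => (5 / 2 * sechProfile y ^ 2) ^ ((1 : ℝ) / 3) := funext Q_eq_rpow
  rw [e]
  refine ((((hasDerivAt_sechProfile x).fun_pow 2).const_mul (5 / 2)).rpow_const
    (Or.inl hpos.ne')).congr_deriv ?_
  rw [Real.rpow_sub_one hpos.ne']
  have := (sechProfile_pos x).ne'
  simp only [Nat.cast_ofNat, Nat.add_one_sub_one, pow_one]
  field_simp

lemma deriv_Q_mul_Q_rpow_half (x : ℝ) :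
    deriv Q x * Q x ^ ((1 : ℝ) / 2) = -√(5 / 2) * (tanhProfile x * sechProfile x) := by
  have hs := sechProfile_pos x
  have hpos : 0 < 5 / 2 * sechProfile x ^ 2 := by positivity
  have hQ : Q x * Q x ^ ((1 : ℝ) / 2) = √(5 / 2) * sechProfile x := by
    rw [Q_eq_rpow, ← Real.rpow_mul hpos.le, ← Real.rpow_add hpos]
    norm_num
    rw [← Real.sqrt_eq_rpow, Real.sqrt_mul (by norm_num), Real.sqrt_sq hs.le]
    simp
  rw [(hasDerivAt_Q x).deriv]
  linear_combination -tanhProfile x * hQ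

/-- The points where `3 tanh² (3x/2) = 1` are `± x₀` for a single `x₀`. -/
lemma exists_sechProfile_sq_eq : ∃ x₀ : ℝ, tanhProfile x₀ ≠ 0 ∧
    tanhProfile (-x₀) = -tanhProfile x₀ ∧ sechProfile (-x₀) = sechProfile x₀ ∧
    ∀ x, 2 - 3 * sechProfile x ^ 2 = 0 ↔ x = x₀ ∨ x = -x₀ := by
  have h3 : (√3)⁻¹ ^ 2 = (1 / 3 : ℝ) := by norm_num
  have hp : 0 < (√3)⁻¹ := by positivity
  have ht : tanhProfile (2 / 3 * artanh (√3)⁻¹) = (√3)⁻¹ := by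
    have : 3 * (2 / 3 * artanh (√3)⁻¹) / 2 = artanh (√3)⁻¹ := by ring
    rw [tanhProfile, this, tanh_artanh]
    constructor <;> nlinarith
  have hneg : ∀ x, tanhProfile (-x) = -tanhProfile x := fun x => by
    rw [tanhProfile, tanhProfile, ← tanh_neg]
    congr 1
    ring
  have hinj : Function.Injective tanhProfile := fun x y h => by
    have := tanh_injective h
    linarith
  refine ⟨_, by rw [ht]; exact hp.ne', hneg _, ?_, fun x => ?_⟩
  · rw [sechProfile, sechProfile, ← cosh_neg]
    congr 2
    ring
  · rw [← hinj.eq_iff (a := x), ← hinj.eq_iff (a := x), hneg, ht, ← sq_eq_sq_iff_eq_or_eq_neg,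
      tanhProfile_sq, h3]
    constructor <;> intro <;> linarith

end GroundState

section Forms

variable {w : ℝ → ℝ}

lemma integrable_sechProfile_sq_mul_sq (hw : Continuous w) (hw2 : Integrable (fun x => w x ^ 2)) :
    Integrable (fun x => sechProfile x ^ 2 * w x ^ 2) := by
  refine hw2.mono' (by fun_prop) (ae_of_all _ fun x => ?_)
  rw [Real.norm_of_nonneg (by positivity)]
  exact mul_le_of_le_one_left (sq_nonneg _)
    (pow_le_one₀ (sechProfile_pos x).le (sechProfile_le_one x))

lemma integrable_mul_mul_sechProfile {m : ℝ → ℝ} (hw : Continuous w)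
    (hw2 : Integrable (fun x => w x ^ 2)) (hm : Continuous m) (hm1 : ∀ x, |m x| ≤ 1) :
    Integrable (fun x => w x * (m x * sechProfile x)) := by
  refine (hw2.add integrable_sechProfile_sq).mono' (by fun_prop) (ae_of_all _ fun x => ?_)
  have h1 := (sq_le_one_iff_abs_le_one _).2 (hm1 x)
  have h2 := mul_nonneg (sub_nonneg.2 h1) (sq_nonneg (sechProfile x))
  rw [Real.norm_eq_abs, abs_le, Pi.add_apply]
  constructor <;> nlinarith [sq_nonneg (w x - m x * sechProfile x),
    sq_nonneg (w x + m x * sechProfile x), sq_nonneg (w x)]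

lemma integral_deriv_sq_add_sixteen_nonneg (hw : ContDiff ℝ 1 w)
    (hw2 : Integrable (fun x => w x ^ 2)) (hw'2 : Integrable (fun x => deriv w x ^ 2)) :
    0 ≤ ∫ x, (deriv w x ^ 2 + 16 * w x ^ 2 - 22 * (sechProfile x ^ 2 * w x ^ 2)) := by
  have hder : ∀ x, HasDerivAt w (deriv w x) x := fun x =>
    (hw.differentiable one_ne_zero x).hasDerivAt
  have hw0 := tendsto_cocompact_zero_of_sq_integrable hder (hw.continuous_deriv le_rfl) hw2 hw'2
  refine integral_nonneg_of_hasDerivAt_le (g := fun x => -4 * (tanhProfile x * w x ^ 2))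
    ((hw'2.add (hw2.const_mul 16)).sub
      ((integrable_sechProfile_sq_mul_sq hw.continuous hw2).const_mul 22)) (fun x => ?_) ?_
  · refine ⟨_, ?_, ((hasDerivAt_tanhProfile x).mul ((hder x).fun_pow 2)).const_mul (-4)⟩
    simp only [Nat.cast_ofNat, Nat.add_one_sub_one, pow_one]
    linear_combination (norm := skip) sq_nonneg (deriv w x + 4 * tanhProfile x * w x)
    have := tanhProfile_sq x
    apply le_of_eq
    linear_combination 16 * w x ^ 2 * this
  · have hsq : Tendsto (fun x => w x ^ 2) (cocompact ℝ) (𝓝 0) := by simpa using hw0.pow 2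
    have : Tendsto (fun x => tanhProfile x * w x ^ 2) (cocompact ℝ) (𝓝 0) := by
      refine squeeze_zero_norm (fun x => ?_) hsq
      rw [norm_mul, Real.norm_of_nonneg (sq_nonneg (w x))]
      exact mul_le_of_le_one_left (sq_nonneg _) (abs_tanhProfile_le_one x)
    simpa using this.const_mul (-4)

/-- The quadratic form of `-∂² - (27/2) sech²(3x/2)`, corrected by multiples of the projections of
`w` on the two eigenfunctions `sech²` and `tanh · sech`. -/
lemma exists_integral_deriv_sq_sub_nonneg (hw : ContDiff ℝ 1 w)
    (hw2 : Integrable (fun x => w x ^ 2)) (hw'2 : Integrable (fun x => deriv w x ^ 2)) :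
    ∃ a b : ℝ, 0 ≤ ∫ x, (deriv w x ^ 2 - 27 / 2 * (sechProfile x ^ 2 * w x ^ 2)
      - a * (w x * (sechProfile x * sechProfile x))
      - b * (w x * (tanhProfile x * sechProfile x))) := by
  have hder : ∀ x, HasDerivAt w (deriv w x) x := fun x =>
    (hw.differentiable one_ne_zero x).hasDerivAt
  have hw0 := tendsto_cocompact_zero_of_sq_integrable hder (hw.continuous_deriv le_rfl) hw2 hw'2
  obtain ⟨x₀, ht0, htn, hsn, hzero⟩ := exists_sechProfile_sq_eq
  -- `w + e` vanishes at the zeros `± x₀` of the threshold resonance `2 - 3 sech²`.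
  have hs0 := (sechProfile_pos x₀).ne'
  obtain ⟨a, ha⟩ : ∃ a, a * sechProfile x₀ ^ 2 = -(w x₀ + w (-x₀)) / 2 :=
    ⟨_, div_mul_cancel₀ _ (pow_ne_zero 2 hs0)⟩
  obtain ⟨b, hb⟩ : ∃ b, b * (tanhProfile x₀ * sechProfile x₀) = -(w x₀ - w (-x₀)) / 2 :=
    ⟨_, div_mul_cancel₀ _ (mul_ne_zero ht0 hs0)⟩
  set e : ℝ → ℝ := fun x => a * sechProfile x ^ 2 + b * (tanhProfile x * sechProfile x) with he
  set e₁ : ℝ → ℝ := fun x => a * (-3 * (tanhProfile x * sechProfile x) * sechProfile x)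
    + b * (3 / 2 * (2 * sechProfile x ^ 3 - sechProfile x)) with he₁
  have hde : ∀ x, HasDerivAt e (e₁ x) x := fun x => by
    have hs := hasDerivAt_sechProfile x
    have ht := hasDerivAt_tanhProfile x
    refine (((hs.fun_pow 2).const_mul a).add ((ht.mul hs).const_mul b)).congr_deriv ?_
    simp only [he₁, Nat.cast_ofNat, Nat.add_one_sub_one, pow_one]
    linear_combination -(3 / 2) * b * sechProfile x * tanhProfile_sq x
  have hde₁ : ∀ x, HasDerivAt e₁ (-(27 / 2) * sechProfile x ^ 2 * e x
      + 9 * a * sechProfile x ^ 2 + 9 / 4 * b * (tanhProfile x * sechProfile x)) x := fun x => by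
    have hs := hasDerivAt_sechProfile x
    have ht := hasDerivAt_tanhProfile x
    refine (((((ht.mul hs).const_mul (-3)).mul hs).const_mul a).add
      (((((hs.fun_pow 3).const_mul 2).sub hs).const_mul (3 / 2)).const_mul b)).congr_deriv ?_
    simp only [he, Nat.cast_ofNat, Nat.add_one_sub_one, Pi.mul_apply]
    linear_combination 9 * a * sechProfile x ^ 2 * tanhProfile_sq x
  refine ⟨18 * a, 9 / 2 * b, integral_nonneg_of_hasDerivAt_le
    (g := fun x => 9 * (tanhProfile x * sechProfile x) * sechProfile x / (2 - 3 * sechProfile x ^ 2)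
      * (w x + e x) ^ 2 - (2 * (w x * e₁ x) + e x * e₁ x + 5 / 2 * a * b * sechProfile x ^ 3))
    ?_ (fun x => ?_) ?_⟩
  · have h1 := integrable_mul_mul_sechProfile hw.continuous hw2 continuous_sechProfile
      (fun x => (abs_of_pos (sechProfile_pos x)).trans_le (sechProfile_le_one x))
    have h2 := integrable_mul_mul_sechProfile hw.continuous hw2 continuous_tanhProfile
      abs_tanhProfile_le_one
    exact ((hw'2.sub ((integrable_sechProfile_sq_mul_sq hw.continuous hw2).const_mul _)).sub
      (h1.const_mul _)).sub (h2.const_mul _)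
  · have hs := hasDerivAt_sechProfile x
    have ht := hasDerivAt_tanhProfile x
    obtain ⟨d, hd, hdd⟩ := exists_hasDerivAt_logDeriv_mul_sq_le
      (φ := fun y => 2 - 3 * sechProfile y ^ 2)
      (φ₁ := fun y => 9 * (tanhProfile y * sechProfile y) * sechProfile y)
      (u := fun y => w y + e y) (V := 27 / 2 * sechProfile x ^ 2) (x := x)
      ((((hs.fun_pow 2).const_mul 3).const_sub 2).congr_deriv (by
        simp only [Nat.cast_ofNat, Nat.add_one_sub_one, pow_one]; ring))
      ((((ht.mul hs).const_mul 9).mul hs).congr_deriv (by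
        simp only [Pi.mul_apply]
        linear_combination -27 * sechProfile x ^ 2 * tanhProfile_sq x))
      ((hder x).add (hde x)) (fun h => by
        have hsx := (sechProfile_pos x).ne'
        rcases (hzero x).1 h with rfl | rfl
        · refine ⟨by positivity, ?_⟩
          simp only [he]
          linear_combination ha + hb
        · refine ⟨?_, ?_⟩
          · rw [htn, hsn]
            have := neg_ne_zero.2 ht0
            positivity
          simp only [he, htn, hsn]
          linear_combination ha - hb)
    refine ⟨_, ?_, hdd.sub (((((hder x).mul (hde₁ x)).const_mul 2).add
      ((hde x).mul (hde₁ x))).add ((hs.fun_pow 3).const_mul (5 / 2 * a * b)))⟩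
    have hpos : 0 ≤ 9 * a ^ 2 * sechProfile x ^ 4
        + 9 / 4 * b ^ 2 * (tanhProfile x * sechProfile x) ^ 2 := by positivity
    have hex : e x = a * sechProfile x ^ 2 + b * (tanhProfile x * sechProfile x) := rfl
    simp only [Nat.cast_ofNat, Nat.add_one_sub_one]
    simp only [hex] at hd ⊢
    linear_combination hd + hpos
  · have hs := tendsto_sechProfile
    have hts : Tendsto (fun x => tanhProfile x * sechProfile x) (cocompact ℝ) (𝓝 0) := by
      refine squeeze_zero_norm (fun x => ?_) hs
      rw [norm_mul, Real.norm_of_nonneg (sechProfile_pos x).le]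
      exact mul_le_of_le_one_left (sechProfile_pos x).le (abs_tanhProfile_le_one x)
    have hte : Tendsto e (cocompact ℝ) (𝓝 0) := by
      simpa using ((hs.pow 2).const_mul a).add (hts.const_mul b)
    have hte₁ : Tendsto e₁ (cocompact ℝ) (𝓝 0) := by
      have h := (((hts.const_mul (-3)).mul hs).const_mul a).add
        (((((hs.pow 3).const_mul 2).sub hs).const_mul (3 / 2)).const_mul b)
      convert h using 2
      simp
    have hq := ((hts.const_mul 9).mul hs).div (((hs.pow 2).const_mul 3).const_sub 2) (by norm_num)
    simpa using (hq.mul ((hw0.add hte).pow 2)).sub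
      ((((hw0.mul hte₁).const_mul 2).add (hte.mul hte₁)).add
        ((hs.pow 3).const_mul (5 / 2 * a * b)))

end Forms

/-- Spectral inequalities for the Schrödinger operators with potential
proportional to `Q³`. -/
theorem spectral_inequalities
    (w : ℝ → ℝ) (hw : ContDiff ℝ (⊤ : ℕ∞) w)
    (hw2 : Integrable (fun x => (w x) ^ 2))
    (hw'2 : Integrable (fun x => (deriv w x) ^ 2)) :
    ((0 ≤ (∫ x : ℝ, (deriv w x) ^ 2) + 16 * (∫ x : ℝ, (w x) ^ 2)
        - (44 / 5) * ∫ x : ℝ, (Q x) ^ 3 * (w x) ^ 2) ∧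
      0 ≤ (∫ x : ℝ, (deriv w x) ^ 2) + (35 / 2) * (∫ x : ℝ, (w x) ^ 2)
        - (47 / 5) * ∫ x : ℝ, (Q x) ^ 3 * (w x) ^ 2) ∧
    ((∫ x : ℝ, w x * (Q x) ^ 3) = 0 →
      (∫ x : ℝ, w x * deriv Q x * Q x ^ ((1:ℝ)/2)) = 0 →
      0 ≤ (∫ x : ℝ, (deriv w x) ^ 2)
        - (27 / 5) * ∫ x : ℝ, (Q x) ^ 3 * (w x) ^ 2) := by
  have hw1 : ContDiff ℝ 1 w := hw.of_le (by exact_mod_cast le_top)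
  have hV := integrable_sechProfile_sq_mul_sq hw1.continuous hw2
  have hQ : ∫ x : ℝ, Q x ^ 3 * w x ^ 2 = 5 / 2 * ∫ x, sechProfile x ^ 2 * w x ^ 2 := by
    rw [← integral_const_mul]
    exact integral_congr_ae (ae_of_all _ fun x => by simp only [Q_pow_three]; ring)
  have hfirst := integral_deriv_sq_add_sixteen_nonneg hw1 hw2 hw'2
  rw [integral_sub (by exact hw'2.add (hw2.const_mul 16)) (hV.const_mul 22),
    integral_add hw'2 (hw2.const_mul 16), integral_const_mul, integral_const_mul] at hfirst
  have hle : ∫ x, sechProfile x ^ 2 * w x ^ 2 ≤ ∫ x, w x ^ 2 :=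
    integral_mono hV hw2 fun x => mul_le_of_le_one_left (sq_nonneg _)
      (pow_le_one₀ (sechProfile_pos x).le (sechProfile_le_one x))
  rw [hQ]
  refine ⟨⟨by linarith, by linarith⟩, fun horth₁ horth₂ => ?_⟩
  have h₁ : ∫ x, w x * (sechProfile x * sechProfile x) = 0 := by
    simp_rw [Q_pow_three] at horth₁
    have e : ∀ x, w x * (5 / 2 * sechProfile x ^ 2)
        = 5 / 2 * (w x * (sechProfile x * sechProfile x)) := fun x => by ring
    simp_rw [e, integral_const_mul] at horth₁
    linarith
  have h₂ : ∫ x, w x * (tanhProfile x * sechProfile x) = 0 := by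
    have e : ∀ x, w x * deriv Q x * Q x ^ ((1:ℝ)/2)
        = -√(5 / 2) * (w x * (tanhProfile x * sechProfile x)) := fun x => by
      rw [mul_assoc, deriv_Q_mul_Q_rpow_half]; ring
    simp_rw [e, integral_const_mul] at horth₂
    exact (mul_eq_zero.1 horth₂).resolve_left (by simp)
  have i₁ := integrable_mul_mul_sechProfile hw1.continuous hw2 continuous_sechProfile
    (fun x => (abs_of_pos (sechProfile_pos x)).trans_le (sechProfile_le_one x))
  have i₂ := integrable_mul_mul_sechProfile hw1.continuous hw2 continuous_tanhProfile
    abs_tanhProfile_le_one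
  obtain ⟨a, b, hab⟩ := exists_integral_deriv_sq_sub_nonneg hw1 hw2 hw'2
  rw [integral_sub (by exact (hw'2.sub (hV.const_mul _)).sub (i₁.const_mul _)) (i₂.const_mul _),
    integral_sub (by exact hw'2.sub (hV.const_mul _)) (i₁.const_mul _),
    integral_sub hw'2 (hV.const_mul _), integral_const_mul, integral_const_mul,
    integral_const_mul, h₁, h₂] at hab
  linarith
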